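/- There exists an absolute constant C ≥ 1 such that the following holds. Suppose α : G⁴ → 𝔽₂ is a multilinear form such that: (a) α is symmetric in its first 3 variables; (b) α(u,u,x₃,x₄) = 0 for all u, x₃, x₄ ∈ G; (c) prank(α + α∘(3 4)) ≤ r. Then there exists a multilinear form α' : G⁴ → 𝔽₂ which is symmetric (in all four variables) and satisfies prank(α + α') ≤ exp(exp(C·r)). -/

import Mathlib

open Finset

/-- `β : (Fin k → V) → ZMod 2` is a multilinear form in the variables indexed by `S`:
it depends only on the coordinates in `S` and is additive (hence `𝔽₂`-linear) in each of
those coordinates. -/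
def MultilinearOn {V : Type*} [AddCommGroup V] [Module (ZMod 2) V] (k : ℕ)
    (S : Finset (Fin k)) (β : (Fin k → V) → ZMod 2) : Prop :=
  (∀ x y : Fin k → V, (∀ i ∈ S, x i = y i) → β x = β y) ∧
  (∀ i ∈ S, ∀ (x : Fin k → V) (u v : V),
    β (Function.update x i (u + v)) = β (Function.update x i u) + β (Function.update x i v))

/-- A multilinear form in all `k` variables. -/
def IsMultilinear {V : Type*} [AddCommGroup V] [Module (ZMod 2) V] (k : ℕ)
    (α : (Fin k → V) → ZMod 2) : Prop :=
  MultilinearOn k Finset.univ α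

/-- `α`, a multilinear form in the variables indexed by `S`, admits a partition-rank
decomposition with `m` terms. -/
def PrankDecompOn {V : Type*} [AddCommGroup V] [Module (ZMod 2) V] (k : ℕ)
    (S : Finset (Fin k)) (m : ℕ) (α : (Fin k → V) → ZMod 2) : Prop :=
  ∃ (I : Fin m → Finset (Fin k)) (β γ : Fin m → ((Fin k → V) → ZMod 2)),
    (∀ i, I i ⊆ S) ∧ (∀ i, I i ≠ ∅) ∧ (∀ i, I i ≠ S) ∧
    (∀ i, MultilinearOn k (I i) (β i)) ∧
    (∀ i, MultilinearOn k (S \ I i) (γ i)) ∧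
    (∀ x, α x = ∑ i, β i x * γ i x)

/-- The partition rank of a multilinear form in the variables indexed by `S`. -/
noncomputable def prankOn {V : Type*} [AddCommGroup V] [Module (ZMod 2) V] (k : ℕ)
    (S : Finset (Fin k)) (α : (Fin k → V) → ZMod 2) : ℕ :=
  sInf {m | PrankDecompOn k S m α}

/-- The partition rank of a multilinear form in `k` variables. -/
noncomputable def prank {V : Type*} [AddCommGroup V] [Module (ZMod 2) V] (k : ℕ)
    (α : (Fin k → V) → ZMod 2) : ℕ :=
  prankOn k Finset.univ α

/-- `α ∘ π`: the form `(x₁, …, x_k) ↦ α(x_{π⁻¹(1)}, …, x_{π⁻¹(k)})`. -/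
def permForm {V : Type*} (k : ℕ) (π : Equiv.Perm (Fin k))
    (α : (Fin k → V) → ZMod 2) : (Fin k → V) → ZMod 2 :=
  fun x => α (fun i => x (π.symm i))

/-- `α` is symmetric in its first `m` variables (0-indexed: coordinates `< m`). -/
def SymmetricInFirst {V : Type*} (k m : ℕ) (α : (Fin k → V) → ZMod 2) : Prop :=
  ∀ i j : Fin k, (i : ℕ) < m → (j : ℕ) < m → permForm k (Equiv.swap i j) α = α

/-- `α` is symmetric in all of its variables. -/
def SymmetricForm {V : Type*} (k : ℕ) (α : (Fin k → V) → ZMod 2) : Prop :=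
  ∀ π : Equiv.Perm (Fin k), permForm k π α = α

/-- `σ` is strongly symmetric: it is symmetric, and the form
`(x, y₃, …, y_k) ↦ σ(x, x, y₃, …, y_k)` is also symmetric.  (Given the symmetry of `σ`,
the latter is equivalent to being allowed to swap the doubled variable with the third
variable, which is how it is stated here.) -/
def StronglySymmetric {V : Type*} (k : ℕ) (σ : (Fin k → V) → ZMod 2) : Prop :=
  SymmetricForm k σ ∧
  ∀ (u v : V) (z : Fin k → V),
    σ (fun i => if (i : ℕ) = 0 ∨ (i : ℕ) = 1 then u else if (i : ℕ) = 2 then v else z i) =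
    σ (fun i => if (i : ℕ) = 0 ∨ (i : ℕ) = 1 then v else if (i : ℕ) = 2 then u else z i)

set_option maxSynthPendingDepth 3

section BilinearForms

variable {V : Type*} [AddCommGroup V] [Module (ZMod 2) V]

/-- The 4-variable form `∑ c i j · e i (x, y) · e j (z, w)`. -/
def tensorForm {ι : Type*} [Fintype ι] (e : ι → (V →ₗ[ZMod 2] V →ₗ[ZMod 2] ZMod 2))
    (c : ι → ι → ZMod 2) (x y z w : V) : ZMod 2 :=
  ∑ i, ∑ j, c i j * (e i x y * e j z w)

/-- The bilinear form `b` vanishes on the common kernel of the functionals in `E`. -/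
def VanishesOnKernel (E : Finset (V →ₗ[ZMod 2] ZMod 2))
    (b : V →ₗ[ZMod 2] V →ₗ[ZMod 2] ZMod 2) : Prop :=
  ∀ x y, (∀ l ∈ E, l x = 0) → (∀ l ∈ E, l y = 0) → b x y = 0

/-- A space `L` of bilinear forms is `K`-regular if no nonzero member of `L` vanishes on the
common kernel of at most `K` linear functionals. -/
def RegularForms (L : Submodule (ZMod 2) (V →ₗ[ZMod 2] V →ₗ[ZMod 2] ZMod 2)) (K : ℕ) : Prop :=
  ∀ E : Finset (V →ₗ[ZMod 2] ZMod 2), E.card ≤ K → ∀ b ∈ L, VanishesOnKernel E b → b = 0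

section TensorForm

variable {ι : Type*} [Fintype ι] {e : ι → (V →ₗ[ZMod 2] V →ₗ[ZMod 2] ZMod 2)}
  {L : Submodule (ZMod 2) (V →ₗ[ZMod 2] V →ₗ[ZMod 2] ZMod 2)}

lemma tensorForm_add (c c' : ι → ι → ZMod 2) (x y z w : V) :
    tensorForm e (c + c') x y z w = tensorForm e c x y z w + tensorForm e c' x y z w := by
  simp only [tensorForm, Pi.add_apply, add_mul, sum_add_distrib]

lemma tensorForm_sum {κ : Type*} (s : Finset κ) (c : κ → ι → ι → ZMod 2) (x y z w : V) :
    tensorForm e (∑ k ∈ s, c k) x y z w = ∑ k ∈ s, tensorForm e (c k) x y z w := by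
  simp only [tensorForm, Finset.sum_apply, sum_mul]
  rw [sum_comm (s := s)]
  exact sum_congr rfl fun i _ => sum_comm

lemma tensorForm_swap (c : ι → ι → ZMod 2) (x y z w : V) :
    tensorForm e c x y z w = tensorForm e (fun i j => c j i) z w x y := by
  simp only [tensorForm]
  rw [sum_comm]
  simp only [mul_comm]

lemma tensorForm_outer (s t : ι → ZMod 2) (x y z w : V) :
    tensorForm e (fun i j => s i * t j) x y z w =
      (∑ i, s i • e i) x y * (∑ i, t i • e i) z w := by
  simp only [tensorForm, LinearMap.sum_apply, LinearMap.smul_apply, smul_eq_mul, sum_mul_sum]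
  exact sum_congr rfl fun i _ => sum_congr rfl fun j _ => by ring

/-- Sums of products of members of the span of `e` are tensor forms in `e`. -/
lemma exists_tensorForm_eq_sum (hspan : ∀ b ∈ L, ∃ t : ι → ZMod 2, ∑ i, t i • e i = b)
    {κ : Type*} (s : Finset κ) (p q : κ → (V →ₗ[ZMod 2] V →ₗ[ZMod 2] ZMod 2))
    (hp : ∀ k, p k ∈ L) (hq : ∀ k, q k ∈ L) :
    ∃ c : ι → ι → ZMod 2, ∀ x y z w,
      tensorForm e c x y z w = ∑ k ∈ s, p k x y * q k z w := by
  choose t ht using fun k => hspan (p k) (hp k)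
  choose u hu using fun k => hspan (q k) (hq k)
  refine ⟨∑ k ∈ s, fun i j => t k i * u k j, fun x y z w => ?_⟩
  rw [tensorForm_sum]
  exact sum_congr rfl fun k _ => by rw [tensorForm_outer, ht, hu]

/-- Transposing the second factor of a tensor form. -/
lemma exists_tensorForm_flip (hspan : ∀ b ∈ L, ∃ t : ι → ZMod 2, ∑ i, t i • e i = b)
    (he : ∀ i, e i ∈ L) (hflip : ∀ b ∈ L, b.flip ∈ L) (c : ι → ι → ZMod 2) :
    ∃ c' : ι → ι → ZMod 2, ∀ x y z w,
      tensorForm e c' x y z w = tensorForm e c x y w z := by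
  obtain ⟨c', hc'⟩ := exists_tensorForm_eq_sum hspan (univ : Finset (ι × ι))
    (fun k => c k.1 k.2 • e k.1) (fun k => (e k.2).flip)
    (fun k => L.smul_mem _ (he _)) (fun k => hflip _ (he _))
  refine ⟨c', fun x y z w => ?_⟩
  rw [hc', Fintype.sum_prod_type]
  simp [tensorForm, mul_assoc]

lemma tensorForm_contract (c : ι → ι → ZMod 2) (x y z w : V) :
    tensorForm e c x y z w = (∑ j, (∑ i, c i j * e i x y) • e j) z w := by
  simp only [tensorForm, LinearMap.sum_apply, LinearMap.smul_apply, smul_eq_mul, sum_mul]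
  rw [sum_comm]
  exact sum_congr rfl fun i _ => sum_congr rfl fun j _ => by ring

lemma tensorForm_eq_zero_coeff (hli : LinearIndependent (ZMod 2) e) {c : ι → ι → ZMod 2}
    (h : ∀ x y z w, tensorForm e c x y z w = 0) : c = 0 := by
  rw [Fintype.linearIndependent_iff] at hli
  have h1 : ∀ x y j, ∑ i, c i j * e i x y = 0 := fun x y =>
    hli _ (LinearMap.ext₂ fun z w => by rw [← tensorForm_contract, h]; rfl)
  funext i j
  refine hli (fun i => c i j) (LinearMap.ext₂ fun x y => ?_) i
  simpa [LinearMap.sum_apply] using h1 x y j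

/-- If a tensor form on the pairing `xy|zw` agrees with a function vanishing as soon as all
`e i` vanish at `(x, z)` and `(x, w)`, then it is zero. -/
lemma tensorForm_eq_zero_of_regular {K : ℕ} (hreg : RegularForms L K)
    (hK : Fintype.card ι ≤ K) (he : ∀ i, e i ∈ L) {c : ι → ι → ZMod 2}
    (h : ∀ x y z w, (∀ i, e i x z = 0) → (∀ i, e i x w = 0) → tensorForm e c x y z w = 0)
    (x y z w : V) : tensorForm e c x y z w = 0 := by
  classical
  rw [tensorForm_contract]
  rw [hreg (univ.image fun i => e i x) (card_image_le.trans (by simpa using hK))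
    (∑ j, (∑ i, c i j * e i x y) • e j) (L.sum_mem fun j _ => L.smul_mem _ (he j))]
  · rfl
  · intro z w hz hw
    rw [← tensorForm_contract]
    exact h x y z w (fun i => hz _ (mem_image_of_mem _ (mem_univ i)))
      (fun i => hw _ (mem_image_of_mem _ (mem_univ i)))

lemma tensorForm_pairings_eq_zero {K : ℕ} (hreg : RegularForms L K)
    (hK : Fintype.card ι ≤ K) (he : ∀ i, e i ∈ L) {c₁ c₂ c₃ : ι → ι → ZMod 2}
    (h : ∀ x y z w, tensorForm e c₁ x y z w + tensorForm e c₂ x z y w +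
      tensorForm e c₃ x w y z = 0) :
    (∀ x y z w, tensorForm e c₁ x y z w = 0) ∧ (∀ x y z w, tensorForm e c₂ x y z w = 0) ∧
      (∀ x y z w, tensorForm e c₃ x y z w = 0) := by
  have key : ∀ (c : ι → ι → ZMod 2) x y z w, (∀ i, e i x y = 0) → tensorForm e c x y z w = 0 :=
    fun c x y z w h0 => by simp [tensorForm, h0]
  have h1 : ∀ x y z w, tensorForm e c₁ x y z w = 0 :=
    tensorForm_eq_zero_of_regular hreg hK he fun x y z w hz hw => by
      simpa [key c₂ x z y w hz, key c₃ x w y z hw] using h x y z w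
  have h2 : ∀ x y z w, tensorForm e c₂ x y z w = 0 :=
    tensorForm_eq_zero_of_regular hreg hK he fun x y z w _ hw => by
      simpa [h1, key c₃ x w z y hw] using h x z y w
  exact ⟨h1, h2, fun x y z w => by simpa [h1, h2] using h x z w y⟩

end TensorForm

/-- A finite-dimensional space of bilinear forms over `𝔽₂` has a basis split into two parts: the
first spans the alternating forms, and the diagonals of the second are linearly independent. -/
lemma exists_adapted_basis (L : Submodule (ZMod 2) (V →ₗ[ZMod 2] V →ₗ[ZMod 2] ZMod 2))
    [FiniteDimensional (ZMod 2) L] :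
    ∃ (m k : ℕ) (e : Fin m ⊕ Fin k → (V →ₗ[ZMod 2] V →ₗ[ZMod 2] ZMod 2)),
      m + k = Module.finrank (ZMod 2) L ∧ LinearIndependent (ZMod 2) e ∧ (∀ i, e i ∈ L) ∧
      (∀ b ∈ L, ∃ t : Fin m ⊕ Fin k → ZMod 2, ∑ i, t i • e i = b) ∧
      (∀ i x, e (Sum.inl i) x x = 0) ∧
      (∀ t : Fin k → ZMod 2, (∀ x, ∑ i, t i * e (Sum.inr i) x x = 0) → t = 0) := by
  let A : Submodule (ZMod 2) L :=
    { carrier := {b | ∀ x, b.1 x x = 0}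
      add_mem' := fun {a b} ha hb x => by simp [ha x, hb x]
      zero_mem' := fun x => by simp
      smul_mem' := fun c b hb x => by simp [hb x] }
  obtain ⟨W, hW⟩ := A.exists_isCompl
  let bA := Module.finBasis (ZMod 2) A
  let bW := Module.finBasis (ZMod 2) W
  let b := (bA.prod bW).map (A.prodEquivOfIsCompl W hW)
  have hl : ∀ i, b (Sum.inl i) = (bA i : L) := fun i => by simp [b]
  have hr : ∀ i, b (Sum.inr i) = (bW i : L) := fun i => by simp [b]
  refine ⟨_, _, fun i => (b i).1, ?_, ?_, fun i => (b i).2, ?_, ?_, ?_⟩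
  · rw [Module.finrank_eq_card_basis b]; simp
  · exact b.linearIndependent.map' L.subtype L.ker_subtype
  · intro p hp
    refine ⟨b.repr ⟨p, hp⟩, ?_⟩
    have h := congrArg L.subtype (b.sum_repr ⟨p, hp⟩)
    rw [map_sum] at h
    exact h
  · intro i x
    simp only [hl]
    exact (bA i).2 x
  · intro t ht
    have hmem : (∑ i, t i • bW i : W).1 ∈ A := fun x => by
      simpa [hr, LinearMap.sum_apply] using ht x
    have h0 : (∑ i, t i • bW i : W) = 0 :=
      Subtype.ext (Submodule.disjoint_def.1 hW.disjoint _ hmem (∑ i, t i • bW i : W).2)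
    exact funext (Fintype.linearIndependent_iff.1 bW.linearIndependent t h0)

/-- If the diagonal of a symmetric tensor, evaluated as `∑ sᵢⱼ eᵢ(x,x) eⱼ(y,y)`, is a bilinear form
in a sufficiently regular space, then that form is zero. -/
lemma eq_zero_of_eq_sum_mul_function {ι : Type*} [Fintype ι]
    {L : Submodule (ZMod 2) (V →ₗ[ZMod 2] V →ₗ[ZMod 2] ZMod 2)}
    (hreg : RegularForms L (2 ^ Fintype.card ι)) {b : V →ₗ[ZMod 2] V →ₗ[ZMod 2] ZMod 2}
    (hb : b ∈ L) (f g : ι → V → ZMod 2) (h : ∀ x y, b x y = ∑ i, f i x * g i y) : b = 0 := by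
  classical
  have hex : ∀ t : ι → ZMod 2, ∃ l : V →ₗ[ZMod 2] ZMod 2,
      ∀ x, (∀ i, f i x = t i) → b x = l := by
    intro t
    by_cases ht : ∃ x, ∀ i, f i x = t i
    · obtain ⟨x, hx⟩ := ht
      refine ⟨b x, fun x' hx' => LinearMap.ext fun y => ?_⟩
      rw [h, h]
      exact sum_congr rfl fun i _ => by rw [hx, hx']
    · exact ⟨0, fun x hx => (ht ⟨x, hx⟩).elim⟩
  choose l hl using hex
  refine hreg (univ.image l) (card_image_le.trans ?_) b hb fun x y _ hy => ?_
  · simp [ZMod.card]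
  · rw [hl (fun i => f i x) x fun _ => rfl]
    exact hy _ (mem_image_of_mem _ (mem_univ _))

/-- A symmetric `𝔽₂`-sum over ordered pairs reduces to the diagonal. -/
lemma sum_sum_eq_sum_diag {ι : Type*} [Fintype ι] (g : ι → ι → ZMod 2)
    (hg : ∀ i j, g i j = g j i) : ∑ i, ∑ j, g i j = ∑ i, g i i := by
  classical
  have key : ∀ s : Finset ι, ∑ i ∈ s, ∑ j ∈ s, g i j = ∑ i ∈ s, g i i := by
    intro s
    induction s using Finset.induction_on with
    | empty => simp
    | insert a s ha ih =>
      rw [sum_insert ha, sum_insert ha, sum_insert ha]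
      simp only [sum_insert ha, sum_add_distrib, ih, hg _ a]
      have := CharTwo.add_self_eq_zero (∑ j ∈ s, g a j)
      linear_combination this
  exact key univ

/-- The symmetrisation of a form that is symmetric and alternating in three variables, and whose
failure of symmetry in the last two variables lies in a regular space of tensors. -/
theorem exists_tensor_correction {L : Submodule (ZMod 2) (V →ₗ[ZMod 2] V →ₗ[ZMod 2] ZMod 2)}
    [FiniteDimensional (ZMod 2) L] (hflip : ∀ b ∈ L, b.flip ∈ L)
    (hreg : RegularForms L (2 ^ Module.finrank (ZMod 2) L))
    (f : V → V → V → V → ZMod 2) (hf₁ : ∀ x y z w, f x y z w = f y x z w)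
    (hf₂ : ∀ x y z w, f x y z w = f x z y w) (hf₀ : ∀ x z w, f x x z w = 0)
    {κ : Type*} [Fintype κ] (p q : κ → Fin 3 → (V →ₗ[ZMod 2] V →ₗ[ZMod 2] ZMod 2))
    (hp : ∀ k i, p k i ∈ L) (hq : ∀ k i, q k i ∈ L)
    (hfpq : ∀ x y z w, f x y z w + f x y w z = ∑ k, (p k 0 x y * q k 0 z w +
      p k 1 x z * q k 1 y w + p k 2 x w * q k 2 y z)) :
    ∃ (ι : Type) (_ : Fintype ι) (e : ι → (V →ₗ[ZMod 2] V →ₗ[ZMod 2] ZMod 2))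
      (c : ι → ι → ZMod 2), Fintype.card ι = Module.finrank (ZMod 2) L ∧
      (∀ x y z w, tensorForm e c x y z w = tensorForm e c y x z w) ∧
      ∀ x y z w, f x y z w + f x y w z =
        tensorForm e c y z x w + tensorForm e c x z y w + tensorForm e c x y z w +
        (tensorForm e c y w x z + tensorForm e c x w y z + tensorForm e c x y w z) := by
  obtain ⟨m, k, e, hmk, hli, heL, hspan, hinl, hinr⟩ := exists_adapted_basis L
  have hcard : Fintype.card (Fin m ⊕ Fin k) = Module.finrank (ZMod 2) L := by simp [hmk]
  have hK : Fintype.card (Fin m ⊕ Fin k) ≤ 2 ^ Module.finrank (ZMod 2) L :=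
    hcard ▸ Nat.lt_two_pow_self.le
  obtain ⟨C, hC⟩ := exists_tensorForm_eq_sum hspan univ (fun k => p k 0) (fun k => q k 0)
    (fun k => hp k 0) (fun k => hq k 0)
  obtain ⟨S, hS⟩ := exists_tensorForm_eq_sum hspan univ (fun k => p k 1) (fun k => q k 1)
    (fun k => hp k 1) (fun k => hq k 1)
  obtain ⟨R, hR⟩ := exists_tensorForm_eq_sum hspan univ (fun k => p k 2) (fun k => q k 2)
    (fun k => hp k 2) (fun k => hq k 2)
  have hφ : ∀ x y z w, f x y z w + f x y w z =
      tensorForm e C x y z w + tensorForm e S x z y w + tensorForm e R x w y z := by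
    intro x y z w
    rw [hfpq, sum_add_distrib, sum_add_distrib, hC, hS, hR]
  obtain ⟨C', hC'⟩ := exists_tensorForm_flip hspan heL hflip C
  obtain ⟨S', hS'⟩ := exists_tensorForm_flip hspan heL hflip S
  have two : ∀ a : ZMod 2, a + a = 0 := CharTwo.add_self_eq_zero
  have eq_of : ∀ {a b : ZMod 2}, a + b = 0 → a = b := fun {a b} h => by
    linear_combination h - two b
  -- symmetry in the last two variables identifies `R` with `S`
  have hRS : ∀ x y z w, tensorForm e R x y z w = tensorForm e S x y z w := by
    have h := (tensorForm_pairings_eq_zero hreg hK heL (c₁ := C + C') (c₂ := S + R)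
      (c₃ := R + S) fun x y z w => by
        simp only [tensorForm_add, hC']
        linear_combination two (f x y z w) + two (f x y w z) - hφ x y z w - hφ x y w z).2.1
    intro x y z w
    have := h x y z w
    rw [tensorForm_add] at this
    exact (eq_of this).symm
  -- symmetry in the first two variables makes `S` symmetric
  have hSS : ∀ x y z w, tensorForm e S x y z w = tensorForm e S z w x y := by
    obtain ⟨D, hD⟩ := exists_tensorForm_flip hspan heL hflip (fun i j => C j i)
    have h := (tensorForm_pairings_eq_zero hreg hK heL (c₁ := C + fun i j => D j i)
      (c₂ := S + fun i j => S j i) (c₃ := S + fun i j => S j i) fun x y z w => by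
        have h₁ := hφ x y z w
        have h₂ := hφ y x z w
        rw [hRS] at h₁ h₂
        simp only [tensorForm_add]
        rw [← tensorForm_swap D, hD, ← tensorForm_swap C, ← tensorForm_swap S,
          ← tensorForm_swap S]
        linear_combination two (f x y z w) + two (f x y w z) - h₁ - h₂ - hf₁ x y z w
          - hf₁ x y w z).2.1
    intro x y z w
    have := h x y z w
    rw [tensorForm_add, ← tensorForm_swap S] at this
    exact eq_of this
  have hCS : ∀ x y z w, tensorForm e C x y z w =
      tensorForm e S x y z w + tensorForm e S x y w z := by
    have h := (tensorForm_pairings_eq_zero hreg hK heL (c₁ := C + (S + S'))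
      (c₂ := C + (S + S')) (c₃ := C + (S + S')) fun x y z w => by
        have h₁ := hφ x y z w
        have h₂ := hφ x z y w
        have h₃ := hφ x w y z
        rw [hRS] at h₁ h₂ h₃
        simp only [tensorForm_add, hS']
        linear_combination two (f x y z w) + two (f x y w z) + two (f x z w y) - h₁ - h₂ - h₃
          - hf₂ x y z w - hf₂ x y w z - hf₂ x z w y).1
    intro x y z w
    have := h x y z w
    rw [tensorForm_add, tensorForm_add, hS'] at this
    exact eq_of this
  have hSsymm : ∀ i j, S i j = S j i := by
    have h := tensorForm_eq_zero_coeff hli (c := S + fun i j => S j i) fun x y z w => by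
      rw [tensorForm_add, ← tensorForm_swap S, ← hSS, two]
    exact fun i j => eq_of (congrFun₂ h i j)
  have hdiag : ∀ x y, ∑ i, S i i * e i x y = ∑ j, (∑ i, S i j * e i x x) * e j y y := by
    intro x y
    have h₁ := hφ x y x y
    rw [hRS, hCS, show f x y x y = 0 by rw [hf₂, hf₀],
      show f x y y x = 0 by rw [hf₁, hf₂, hf₀]] at h₁
    have h₂ : tensorForm e S x y x y = ∑ i, S i i * e i x y := by
      rw [tensorForm, sum_sum_eq_sum_diag _ fun i j => by rw [hSsymm]; ring]
      refine sum_congr rfl fun i _ => ?_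
      have : ∀ a : ZMod 2, a * a = a := by decide
      rw [this]
    have h₃ : tensorForm e S x x y y = ∑ j, (∑ i, S i j * e i x x) * e j y y := by
      rw [tensorForm_contract]
      simp [LinearMap.sum_apply]
    rw [← h₂, ← h₃]
    linear_combination -h₁ - two (tensorForm e S x x y y) - two (tensorForm e S x y y x)
  have hzero : ∑ i, S i i • e i = 0 := by
    refine eq_zero_of_eq_sum_mul_function (ι := Fin m ⊕ Fin k) (hcard ▸ hreg)
      (L.sum_mem fun i _ => L.smul_mem _ (heL i)) (fun j x => ∑ i, S i j * e i x x)
      (fun j y => e j y y) fun x y => ?_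
    rw [← hdiag]
    simp [LinearMap.sum_apply]
  have hSdiag : ∀ i, S i i = 0 := Fintype.linearIndependent_iff.1 hli _ hzero
  have hSinr : ∀ i j, S (Sum.inr i) (Sum.inr j) = 0 := by
    have h₁ : ∀ x, (fun j => ∑ i, S (Sum.inr i) (Sum.inr j) * e (Sum.inr i) x x) = 0 := by
      refine fun x => hinr _ fun y => ?_
      have := hdiag x y
      simpa [hSdiag, hinl] using this.symm
    exact fun i j => congrFun (hinr (fun i => S (Sum.inr i) (Sum.inr j))
      fun x => congrFun (h₁ x) j) i
  let c : Fin m ⊕ Fin k → Fin m ⊕ Fin k → ZMod 2 := fun i j =>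
    match i, j with
    | Sum.inl i, Sum.inl j => if i < j then S (Sum.inl i) (Sum.inl j) else 0
    | Sum.inl i, Sum.inr j => S (Sum.inl i) (Sum.inr j)
    | Sum.inr _, _ => 0
  have hcS : (c + fun i j => c j i) = S := by
    funext i j
    rcases i with i | i <;> rcases j with j | j
    · rcases lt_trichotomy i j with h | h | h
      · simp [c, h, h.not_gt]
      · simp [c, h, hSdiag]
      · simp [c, h, h.not_gt, hSsymm (Sum.inl i)]
    · simp [c]
    · simp [c, hSsymm (Sum.inr i)]
    · simp [c, hSinr]
  have hcc : ∀ x y z w, tensorForm e c x y z w + tensorForm e c z w x y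
      = tensorForm e S x y z w := by
    intro x y z w
    rw [← hcS, tensorForm_add, ← tensorForm_swap c]
  have halt : ∀ i x y, e (Sum.inl i) x y = e (Sum.inl i) y x := by
    intro i x y
    have h := hinl i (x + y)
    simp only [map_add, LinearMap.add_apply, hinl, zero_add, add_zero] at h
    exact eq_of (by rw [add_comm]; exact h)
  have hcsymm : ∀ x y z w, tensorForm e c x y z w = tensorForm e c y x z w := by
    intro x y z w
    simp only [tensorForm, Fintype.sum_sum_type]
    simp [c, fun i => halt i x y]
  refine ⟨_, inferInstance, e, c, hcard, hcsymm, fun x y z w => ?_⟩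
  have h₁ := hφ x y z w
  rw [hRS, hCS, ← hcc x y z w, ← hcc x y w z, ← hcc x z y w, ← hcc x w y z] at h₁
  linear_combination h₁ + two (tensorForm e c z w x y) - hcsymm z w x y

/-- Energy-increment regularisation: any finite set of functionals can be enlarged so that no form
in `L` starts to vanish after adding `K` further functionals. -/
lemma exists_regular_kernel [DecidableEq (V →ₗ[ZMod 2] ZMod 2)]
    (L : Finset (V →ₗ[ZMod 2] V →ₗ[ZMod 2] ZMod 2)) (h0 : 0 ∈ L) (K : ℕ)
    (E₀ : Finset (V →ₗ[ZMod 2] ZMod 2)) :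
    ∃ E, E₀ ⊆ E ∧ E.card ≤ E₀.card + (L.card - 1) * K ∧
      ∀ E', E'.card ≤ K → ∀ b ∈ L, VanishesOnKernel (E ∪ E') b → VanishesOnKernel E b := by
  classical
  have hmono : ∀ {E E' : Finset (V →ₗ[ZMod 2] ZMod 2)} {b}, E ⊆ E' → VanishesOnKernel E b →
      VanishesOnKernel E' b := fun h hb x y hx hy =>
    hb x y (fun l hl => hx l (h hl)) (fun l hl => hy l (h hl))
  have key : ∀ (N : ℕ) (E₀ : Finset (V →ₗ[ZMod 2] ZMod 2)),
      (L.filter fun b => ¬ VanishesOnKernel E₀ b).card ≤ N →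
      ∃ E, E₀ ⊆ E ∧ E.card ≤ E₀.card + N * K ∧
        ∀ E', E'.card ≤ K → ∀ b ∈ L, VanishesOnKernel (E ∪ E') b → VanishesOnKernel E b := by
    intro N
    induction N with
    | zero =>
      intro E₀ h
      refine ⟨E₀, subset_rfl, by simp, fun E' _ b hb _ => ?_⟩
      by_contra hn
      have := card_eq_zero.1 (Nat.le_zero.1 h)
      exact notMem_empty b (this ▸ mem_filter.2 ⟨hb, hn⟩)
    | succ N ih =>
      intro E₀ h
      by_cases hreg : ∀ E', E'.card ≤ K → ∀ b ∈ L, VanishesOnKernel (E₀ ∪ E') b →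
          VanishesOnKernel E₀ b
      · exact ⟨E₀, subset_rfl, by simp, hreg⟩
      · push Not at hreg
        obtain ⟨E', hE', b, hb, hv, hn⟩ := hreg
        obtain ⟨E, hE, hcard, hr⟩ := ih (E₀ ∪ E') (by
          refine Nat.le_of_lt_succ (lt_of_lt_of_le (card_lt_card ?_) h)
          refine (ssubset_iff_of_subset fun a ha => ?_).2
            ⟨b, mem_filter.2 ⟨hb, hn⟩, fun h => (mem_filter.1 h).2 hv⟩
          rw [mem_filter] at ha ⊢
          exact ⟨ha.1, fun h => ha.2 (hmono subset_union_left h)⟩)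
        refine ⟨E, subset_union_left.trans hE, hcard.trans ?_, hr⟩
        have := card_union_le E₀ E'
        nlinarith
  refine key _ _ ((card_le_card fun b hb => ?_).trans (card_erase_of_mem h0).le)
  rw [mem_filter] at hb
  exact mem_erase.2 ⟨fun h => hb.2 (h ▸ fun _ _ _ _ => rfl), hb.1⟩

/-- A projection onto the common kernel of finitely many functionals. -/
lemma exists_projection (E : Finset (V →ₗ[ZMod 2] ZMod 2)) :
    ∃ (P : V →ₗ[ZMod 2] V) (s : E → V), (∀ x, ∀ l ∈ E, l (P x) = 0) ∧
      ∀ x, x = P x + ∑ l : E, l.1 x • s l := by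
  classical
  let Λ : V →ₗ[ZMod 2] (E → ZMod 2) := LinearMap.pi fun l => l.1
  obtain ⟨s, hs⟩ := Λ.rangeRestrict.exists_rightInverse_of_surjective Λ.range_rangeRestrict
  obtain ⟨t, ht⟩ := LinearMap.exists_extend s
  have hΛ : ∀ x, Λ (t (Λ x)) = Λ x := by
    intro x
    have h₁ : t (Λ x) = s (Λ.rangeRestrict x) := LinearMap.congr_fun ht (Λ.rangeRestrict x)
    rw [h₁]
    exact congrArg Subtype.val (LinearMap.congr_fun hs (Λ.rangeRestrict x))
  refine ⟨LinearMap.id - t ∘ₗ Λ, fun l => t fun j => if l = j then 1 else 0, ?_, ?_⟩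
  · intro x l hl
    have := congrFun (hΛ x) ⟨l, hl⟩
    simp only [Λ, LinearMap.pi_apply] at this
    simp [Λ, this]
  · intro x
    have := LinearMap.pi_apply_eq_sum_univ t (Λ x)
    simp only [LinearMap.sub_apply, LinearMap.id_apply, LinearMap.comp_apply]
    rw [this]
    simp [Λ]

end BilinearForms
section MultilinearForms

variable {V : Type*} [AddCommGroup V] [Module (ZMod 2) V] {k : ℕ}

/-- The linear functional obtained by freezing all coordinates but one. -/
def MultilinearOn.coord {S : Finset (Fin k)} {β : (Fin k → V) → ZMod 2}
    (h : MultilinearOn k S β) {i : Fin k} (hi : i ∈ S) (x : Fin k → V) : V →ₗ[ZMod 2] ZMod 2 :=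
  (AddMonoidHom.mk' (fun v => β (Function.update x i v)) (h.2 i hi x)).toZModLinearMap 2

@[simp]
lemma MultilinearOn.coord_apply {S : Finset (Fin k)} {β : (Fin k → V) → ZMod 2}
    (h : MultilinearOn k S β) {i : Fin k} (hi : i ∈ S) (x : Fin k → V) (v : V) :
    h.coord hi x v = β (Function.update x i v) := rfl

lemma MultilinearOn.exists_linear {i : Fin k} {β : (Fin k → V) → ZMod 2}
    (h : MultilinearOn k {i} β) : ∃ l : V →ₗ[ZMod 2] ZMod 2, ∀ x, β x = l (x i) :=
  ⟨h.coord (mem_singleton_self i) 0, fun x => by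
    rw [h.coord_apply]
    exact h.1 _ _ (by simp)⟩

lemma MultilinearOn.exists_bilinear {i j : Fin k} (hij : i ≠ j) {β : (Fin k → V) → ZMod 2}
    (h : MultilinearOn k {i, j} β) :
    ∃ b : V →ₗ[ZMod 2] V →ₗ[ZMod 2] ZMod 2, ∀ x, β x = b (x i) (x j) := by
  have hi : i ∈ ({i, j} : Finset (Fin k)) := by simp
  have hj : j ∈ ({i, j} : Finset (Fin k)) := by simp
  refine ⟨(AddMonoidHom.mk' (fun u => h.coord hj (Function.update 0 i u)) fun u v =>
    LinearMap.ext fun w => ?_).toZModLinearMap 2, fun x => ?_⟩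
  · simp only [MultilinearOn.coord_apply, LinearMap.add_apply, Function.update_comm hij]
    exact h.2 i hi _ u v
  · refine h.1 x (Function.update (Function.update 0 i (x i)) j (x j)) fun t ht => ?_
    rcases mem_insert.1 ht with rfl | ht
    · simp [hij]
    · rw [mem_singleton.1 ht]; simp

lemma multilinearOn_linear (l : V →ₗ[ZMod 2] ZMod 2) (i : Fin k) :
    MultilinearOn k {i} fun x => l (x i) := by
  refine ⟨fun x y h => congrArg l (h i (mem_singleton_self i)), fun t ht x u v => ?_⟩
  obtain rfl := mem_singleton.1 ht
  simp

lemma multilinearOn_bilinear (b : V →ₗ[ZMod 2] V →ₗ[ZMod 2] ZMod 2) {i j : Fin k} (hij : i ≠ j) :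
    MultilinearOn k {i, j} fun x => b (x i) (x j) := by
  refine ⟨fun x y h => by simp only [h i (by simp), h j (by simp)], fun t ht x u v => ?_⟩
  rcases mem_insert.1 ht with rfl | ht
  · simp [hij.symm]
  · obtain rfl := mem_singleton.1 ht
    simp [hij]

lemma IsMultilinear.add {α β : (Fin k → V) → ZMod 2} (hα : IsMultilinear k α)
    (hβ : IsMultilinear k β) : IsMultilinear k (α + β) :=
  ⟨fun x y h => by rw [Pi.add_apply, Pi.add_apply, hα.1 x y h, hβ.1 x y h], fun i hi x u v => by
    simp only [Pi.add_apply, hα.2 i hi, hβ.2 i hi]; ring⟩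

lemma isMultilinear_sum {κ : Type*} (s : Finset κ) {α : κ → (Fin k → V) → ZMod 2}
    (hα : ∀ i, IsMultilinear k (α i)) : IsMultilinear k fun x => ∑ i ∈ s, α i x :=
  ⟨fun x y h => sum_congr rfl fun i _ => (hα i).1 x y h, fun j hj x u v => by
    rw [← sum_add_distrib]; exact sum_congr rfl fun i _ => (hα i).2 j hj x u v⟩

lemma MultilinearOn.const_mul {S : Finset (Fin k)} {β : (Fin k → V) → ZMod 2}
    (h : MultilinearOn k S β) (c : ZMod 2) : MultilinearOn k S fun x => c * β x :=
  ⟨fun x y hxy => by simp only [h.1 x y hxy], fun i hi x u v => by simp only [h.2 i hi, mul_add]⟩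

lemma MultilinearOn.mul_compl {I : Finset (Fin k)} {β γ : (Fin k → V) → ZMod 2}
    (hβ : MultilinearOn k I β) (hγ : MultilinearOn k (univ \ I) γ) :
    IsMultilinear k fun x => β x * γ x := by
  refine ⟨fun x y h => by rw [funext fun i => h i (mem_univ i)], fun i _ x u v => ?_⟩
  by_cases hi : i ∈ I
  · have h : ∀ w, γ (Function.update x i w) = γ x := fun w =>
      hγ.1 _ _ fun j hj => Function.update_of_ne (by rintro rfl; exact (mem_sdiff.1 hj).2 hi) _ _
    simp only [h, hβ.2 i hi, add_mul]
  · have h : ∀ w, β (Function.update x i w) = β x := fun w =>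
      hβ.1 _ _ fun j hj => Function.update_of_ne (by rintro rfl; exact hi hj) _ _
    simp only [h, hγ.2 i (mem_sdiff.2 ⟨mem_univ i, hi⟩), mul_add]

lemma update_apply_linear (A : Fin k → (V →ₗ[ZMod 2] V)) (x : Fin k → V) (j : Fin k) (w : V) :
    (fun t => A t (Function.update x j w t)) =
      Function.update (fun t => A t (x t)) j (A j w) := by
  funext t
  by_cases h : t = j
  · subst h; simp
  · simp [h]

lemma IsMultilinear.comp_linear {α : (Fin k → V) → ZMod 2} (hα : IsMultilinear k α)
    (A : Fin k → (V →ₗ[ZMod 2] V)) : IsMultilinear k fun x => α fun t => A t (x t) := by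
  refine ⟨fun x y h => by rw [funext fun i => h i (mem_univ i)], fun i hi x u v => ?_⟩
  simp only [update_apply_linear, map_add, hα.2 i hi]

lemma IsMultilinear.comp_linear_update {α : (Fin k → V) → ZMod 2} (hα : IsMultilinear k α)
    (A : Fin k → (V →ₗ[ZMod 2] V)) (i : Fin k) (v : V) :
    MultilinearOn k (univ \ {i}) fun x => α (Function.update (fun t => A t (x t)) i v) := by
  refine ⟨fun x y h => ?_, fun j hj x u w => ?_⟩
  · refine congrArg α (funext fun t => ?_)
    by_cases ht : t = i
    · subst ht; simp
    · simp [ht, h t (by simp [ht])]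
  · have hji : j ≠ i := fun h => (mem_sdiff.1 hj).2 (mem_singleton.2 h)
    simp only [update_apply_linear, map_add, Function.update_comm hji, hα.2 j (mem_univ j)]

lemma IsMultilinear.comp_perm {α : (Fin k → V) → ZMod 2} (hα : IsMultilinear k α)
    (π : Equiv.Perm (Fin k)) : IsMultilinear k (permForm k π α) := by
  refine ⟨fun x y h => by rw [funext fun i => h i (mem_univ i)], fun i _ x u v => ?_⟩
  have h : ∀ w, (fun t => Function.update x i w (π.symm t)) =
      Function.update (fun t => x (π.symm t)) (π i) w := by
    intro w
    funext t
    by_cases ht : t = π i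
    · subst ht; simp
    · have : π.symm t ≠ i := fun h => ht (by rw [← h, π.apply_symm_apply])
      simp [ht, this]
  simp only [permForm, h, hα.2 (π i) (mem_univ _)]

/-- A partition-rank decomposition whose terms are indexed by a finite type. -/
def PrankDecompIndexed (k : ℕ) (κ : Type*) [Fintype κ] (α : (Fin k → V) → ZMod 2) : Prop :=
  ∃ (I : κ → Finset (Fin k)) (β γ : κ → ((Fin k → V) → ZMod 2)),
    (∀ i, I i ≠ ∅) ∧ (∀ i, I i ≠ univ) ∧ (∀ i, MultilinearOn k (I i) (β i)) ∧
    (∀ i, MultilinearOn k (univ \ I i) (γ i)) ∧ ∀ x, α x = ∑ i, β i x * γ i x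

namespace PrankDecompIndexed

variable {κ κ' : Type*} [Fintype κ] [Fintype κ'] {α α' : (Fin k → V) → ZMod 2}

lemma prankDecompOn (h : PrankDecompIndexed k κ α) :
    PrankDecompOn k univ (Fintype.card κ) α := by
  obtain ⟨I, β, γ, h₁, h₂, h₃, h₄, h₅⟩ := h
  let f := (Fintype.equivFin κ).symm
  exact ⟨fun i => I (f i), fun i => β (f i), fun i => γ (f i), fun i => subset_univ _,
    fun i => h₁ _, fun i => h₂ _, fun i => h₃ _, fun i => h₄ _, fun x => by
      rw [h₅, ← f.sum_comp]⟩

lemma prank_le (h : PrankDecompIndexed k κ α) : prank k α ≤ Fintype.card κ :=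
  Nat.sInf_le h.prankDecompOn

lemma add (h : PrankDecompIndexed k κ α) (h' : PrankDecompIndexed k κ' α') :
    PrankDecompIndexed k (κ ⊕ κ') (α + α') := by
  obtain ⟨I, β, γ, h₁, h₂, h₃, h₄, h₅⟩ := h
  obtain ⟨I', β', γ', h₁', h₂', h₃', h₄', h₅'⟩ := h'
  refine ⟨Sum.elim I I', Sum.elim β β', Sum.elim γ γ', ?_, ?_, ?_, ?_, fun x => ?_⟩
  · rintro (i | i); exacts [h₁ i, h₁' i]
  · rintro (i | i); exacts [h₂ i, h₂' i]
  · rintro (i | i); exacts [h₃ i, h₃' i]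
  · rintro (i | i); exacts [h₄ i, h₄' i]
  · simp [h₅, h₅']

lemma isMultilinear (h : PrankDecompIndexed k κ α) : IsMultilinear k α := by
  obtain ⟨I, β, γ, -, -, h₃, h₄, h₅⟩ := h
  rw [funext h₅]
  exact isMultilinear_sum _ fun i => (h₃ i).mul_compl (h₄ i)

end PrankDecompIndexed

/-- Precomposing a multilinear form with a projection along finitely many vectors changes it by a
form of small partition rank. -/
lemma IsMultilinear.prankDecompIndexed_add_comp {α : (Fin 4 → V) → ZMod 2}
    (hα : IsMultilinear 4 α) {E : Finset (V →ₗ[ZMod 2] ZMod 2)} {P : V →ₗ[ZMod 2] V} {s : E → V}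
    (hP : ∀ x, x = P x + ∑ l : E, l.1 x • s l) :
    PrankDecompIndexed 4 (Fin 4 × E) (α + fun x => α fun t => P (x t)) := by
  let A : Fin 4 → Fin 4 → (V →ₗ[ZMod 2] V) := fun i t => if t < i then P else LinearMap.id
  refine ⟨fun p => {p.1}, fun p x => p.2.1 (x p.1),
    fun p x => α (Function.update (fun t => A p.1 t (x t)) p.1 (s p.2)), ?_, ?_, ?_, ?_, ?_⟩
  · intro p; simp
  · have h : ∀ i : Fin 4, ({i} : Finset (Fin 4)) ≠ univ := by decide
    exact fun p => h p.1
  · exact fun p => multilinearOn_linear _ _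
  · exact fun p => hα.comp_linear_update _ _ _
  · intro x
    have telescope : ∀ i : Fin 4,
        ∑ l : E, l.1 (x i) * α (Function.update (fun t => A i t (x t)) i (s l))
        = α (Function.update (fun t => A i t (x t)) i (x i)) -
          α (Function.update (fun t => A i t (x t)) i (P (x i))) := by
      intro i
      have h := congrArg (MultilinearOn.coord hα (mem_univ i) (fun t => A i t (x t))) (hP (x i))
      rw [map_add, map_sum] at h
      simp only [map_smul, smul_eq_mul] at h
      exact eq_sub_of_add_eq' h.symm
    rw [Fintype.sum_prod_type]
    simp only [telescope, Fin.sum_univ_four]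
    have e₀ : Function.update (fun t => A 0 t (x t)) 0 (x 0) = x := by
      funext t; fin_cases t <;> simp [A]
    have e₁ : Function.update (fun t => A 0 t (x t)) 0 (P (x 0)) =
        Function.update (fun t => A 1 t (x t)) 1 (x 1) := by
      funext t; fin_cases t <;> simp [A]
    have e₂ : Function.update (fun t => A 1 t (x t)) 1 (P (x 1)) =
        Function.update (fun t => A 2 t (x t)) 2 (x 2) := by
      funext t; fin_cases t <;> simp [A]
    have e₃ : Function.update (fun t => A 2 t (x t)) 2 (P (x 2)) =
        Function.update (fun t => A 3 t (x t)) 3 (x 3) := by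
      funext t; fin_cases t <;> simp [A]
    have e₄ : Function.update (fun t => A 3 t (x t)) 3 (P (x 3)) = fun t => P (x t) := by
      funext t; fin_cases t <;> simp [A]
    rw [e₀, e₁, e₂, e₃, e₄, Pi.add_apply]
    linear_combination CharTwo.add_self_eq_zero (α fun t => P (x t))

/-- Multilinear forms on a finite space attain their partition rank. -/
lemma IsMultilinear.prankDecompOn_prank [Finite V] {α : (Fin 4 → V) → ZMod 2}
    (hα : IsMultilinear 4 α) : PrankDecompOn 4 univ (prank 4 α) α := by
  have : Finite (V →ₗ[ZMod 2] ZMod 2) := DFunLike.finite _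
  obtain ⟨P, s, hP, hs⟩ :=
    exists_projection (Set.toFinite (Set.univ : Set (V →ₗ[ZMod 2] ZMod 2))).toFinset
  have hP₀ : ∀ x, P x = 0 := fun x =>
    (Module.forall_dual_apply_eq_zero_iff (ZMod 2) _).1 fun l => hP x l (by simp)
  have hα₀ : (fun x : Fin 4 → V => α fun t => P (x t)) = 0 := by
    funext x
    have h : α (Function.update 0 0 0) = 0 := map_zero (MultilinearOn.coord hα (mem_univ 0) 0)
    have h' : Function.update (0 : Fin 4 → V) 0 0 = 0 := Function.update_eq_self (0 : Fin 4) _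
    rw [h'] at h
    simp only [hP₀]
    exact h
  have h := hα.prankDecompIndexed_add_comp hs
  rw [hα₀, add_zero] at h
  exact Nat.sInf_mem (s := {m | PrankDecompOn 4 univ m α}) ⟨_, h.prankDecompOn⟩

/-- A single term of a partition-rank decomposition, restricted to the kernel of a suitable linear
functional, is a sum of products of two bilinear forms. -/
lemma exists_bilinear_factors {I : Finset (Fin 4)} {β γ : (Fin 4 → V) → ZMod 2} (h₁ : I ≠ ∅)
    (h₂ : I ≠ univ) (hβ : MultilinearOn 4 I β) (hγ : MultilinearOn 4 (univ \ I) γ) :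
    ∃ (l : V →ₗ[ZMod 2] ZMod 2) (p q : Fin 3 → (V →ₗ[ZMod 2] V →ₗ[ZMod 2] ZMod 2)),
      ∀ x, (∀ i, l (x i) = 0) → β x * γ x = p 0 (x 0) (x 1) * q 0 (x 2) (x 3) +
        p 1 (x 0) (x 2) * q 1 (x 1) (x 3) + p 2 (x 0) (x 3) * q 2 (x 1) (x 2) := by
  have hI : (∃ i, I = {i}) ∨ (∃ i, univ \ I = {i}) ∨ (I = {0, 1} ∧ univ \ I = {2, 3}) ∨
      (I = {2, 3} ∧ univ \ I = {0, 1}) ∨ (I = {0, 2} ∧ univ \ I = {1, 3}) ∨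
      (I = {1, 3} ∧ univ \ I = {0, 2}) ∨ (I = {0, 3} ∧ univ \ I = {1, 2}) ∨
      (I = {1, 2} ∧ univ \ I = {0, 3}) := by
    clear hβ hγ; revert I; decide
  rcases hI with ⟨i, hi⟩ | ⟨i, hi⟩ | ⟨hi, hj⟩ | ⟨hi, hj⟩ | ⟨hi, hj⟩ | ⟨hi, hj⟩ | ⟨hi, hj⟩ | ⟨hi, hj⟩
  · obtain ⟨l, hl⟩ := (hi ▸ hβ).exists_linear
    exact ⟨l, 0, 0, fun x hx => by simp [hl, hx]⟩
  · obtain ⟨l, hl⟩ := (hi ▸ hγ).exists_linear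
    exact ⟨l, 0, 0, fun x hx => by simp [hl, hx]⟩
  all_goals
    rw [hj] at hγ
    rw [hi] at hβ
    obtain ⟨b, hb⟩ := hβ.exists_bilinear (by decide)
    obtain ⟨c, hc⟩ := hγ.exists_bilinear (by decide)
  · exact ⟨0, ![b, 0, 0], ![c, 0, 0], fun x _ => by simp [hb, hc]⟩
  · exact ⟨0, ![c, 0, 0], ![b, 0, 0], fun x _ => by simp [hb, hc, mul_comm]⟩
  · exact ⟨0, ![0, b, 0], ![0, c, 0], fun x _ => by simp [hb, hc]⟩
  · exact ⟨0, ![0, c, 0], ![0, b, 0], fun x _ => by simp [hb, hc, mul_comm]⟩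
  · exact ⟨0, ![0, 0, b], ![0, 0, c], fun x _ => by simp [hb, hc]⟩
  · exact ⟨0, ![0, 0, c], ![0, 0, b], fun x _ => by simp [hb, hc, mul_comm]⟩

/-- Tensor forms on the three pairings have bounded partition rank. -/
lemma prankDecompIndexed_tensorForm {ι : Type*} [Fintype ι]
    (e : ι → (V →ₗ[ZMod 2] V →ₗ[ZMod 2] ZMod 2)) (c : ι → ι → ZMod 2) :
    PrankDecompIndexed 4 (Fin 3 × ι × ι) fun x =>
      tensorForm e c (x 1) (x 2) (x 0) (x 3) + tensorForm e c (x 0) (x 2) (x 1) (x 3) +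
        tensorForm e c (x 0) (x 1) (x 2) (x 3) := by
  let I : Fin 3 → Fin 4 × Fin 4 := ![(1, 2), (0, 2), (0, 1)]
  let J : Fin 3 → Fin 4 × Fin 4 := ![(0, 3), (1, 3), (2, 3)]
  have hI : ∀ i, (I i).1 ≠ (I i).2 := by decide
  have hJ : ∀ i, (J i).1 ≠ (J i).2 := by decide
  have hIJ : ∀ i, univ \ {(I i).1, (I i).2} = ({(J i).1, (J i).2} : Finset (Fin 4)) := by decide
  have hIu : ∀ i, ({(I i).1, (I i).2} : Finset (Fin 4)) ≠ univ := by decide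
  refine ⟨fun p => {(I p.1).1, (I p.1).2},
    fun p x => c p.2.1 p.2.2 * e p.2.1 (x (I p.1).1) (x (I p.1).2),
    fun p x => e p.2.2 (x (J p.1).1) (x (J p.1).2), fun p => insert_ne_empty _ _,
    fun p => hIu _, fun p => (multilinearOn_bilinear _ (hI p.1)).const_mul _, fun p => ?_,
    fun x => ?_⟩
  · rw [hIJ]
    exact multilinearOn_bilinear _ (hJ p.1)
  · simp [Fintype.sum_prod_type, Fin.sum_univ_three, tensorForm, I, J, mul_assoc]

/-- Symmetry of a 4-variable form may be checked on adjacent transpositions. -/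
lemma symmetricForm_four {X : Type*} {α : (Fin 4 → X) → ZMod 2}
    (h₀ : ∀ x y z w, α ![x, y, z, w] = α ![y, x, z, w])
    (h₁ : ∀ x y z w, α ![x, y, z, w] = α ![x, z, y, w])
    (h₂ : ∀ x y z w, α ![x, y, z, w] = α ![x, y, w, z]) : SymmetricForm 4 α := by
  have hx : ∀ x : Fin 4 → X, x = ![x 0, x 1, x 2, x 3] := fun x => by
    funext t; fin_cases t <;> rfl
  intro π
  have hπ : π ∈ Submonoid.closure (Set.range fun i : Fin 3 => Equiv.swap i.castSucc i.succ) := by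
    rw [Equiv.Perm.mclosure_swap_castSucc_succ]; trivial
  induction hπ using Submonoid.closure_induction with
  | mem π hπ =>
    obtain ⟨i, rfl⟩ := hπ
    funext x
    rw [permForm, hx fun _ => _]
    conv_rhs => rw [hx x]
    fin_cases i
    · exact (h₀ _ _ _ _).symm
    · exact (h₁ _ _ _ _).symm
    · exact (h₂ _ _ _ _).symm
  | one => rfl
  | mul π τ _ _ h h' =>
    calc permForm 4 (π * τ) α = permForm 4 τ (permForm 4 π α) := rfl
    _ = α := by rw [h, h']

end MultilinearForms

section SymmetryExtension

variable {V : Type*} [AddCommGroup V] [Module (ZMod 2) V]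

/-- Precomposition of both arguments of a bilinear form with a linear map. -/
def precompBilinear (P : V →ₗ[ZMod 2] V) :
    (V →ₗ[ZMod 2] V →ₗ[ZMod 2] ZMod 2) →ₗ[ZMod 2] (V →ₗ[ZMod 2] V →ₗ[ZMod 2] ZMod 2) where
  toFun b := b.compl₁₂ P P
  map_add' _ _ := rfl
  map_smul' _ _ := rfl

@[simp]
lemma precompBilinear_apply (P : V →ₗ[ZMod 2] V) (b : V →ₗ[ZMod 2] V →ₗ[ZMod 2] ZMod 2)
    (x y : V) : precompBilinear P b x y = b (P x) (P y) := rfl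

/-- A space of bilinear forms becomes regular after a projection of small corank. -/
lemma exists_regular_projection [Finite V]
    (L : Submodule (ZMod 2) (V →ₗ[ZMod 2] V →ₗ[ZMod 2] ZMod 2)) {D : ℕ}
    (hL : Module.finrank (ZMod 2) L ≤ D) (E₀ : Finset (V →ₗ[ZMod 2] ZMod 2)) :
    ∃ (E : Finset (V →ₗ[ZMod 2] ZMod 2)) (P : V →ₗ[ZMod 2] V) (s : E → V), E₀ ⊆ E ∧
      E.card ≤ E₀.card + (2 ^ D - 1) * 2 ^ D ∧ (∀ x, ∀ l ∈ E, l (P x) = 0) ∧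
      (∀ x, x = P x + ∑ l : E, l.1 x • s l) ∧ RegularForms (L.map (precompBilinear P)) (2 ^ D) := by
  classical
  have : Finite (V →ₗ[ZMod 2] ZMod 2) := DFunLike.finite _
  have : Finite (V →ₗ[ZMod 2] V →ₗ[ZMod 2] ZMod 2) := DFunLike.finite _
  let F := (Set.toFinite (L : Set (V →ₗ[ZMod 2] V →ₗ[ZMod 2] ZMod 2))).toFinset
  have hF : F.card ≤ 2 ^ D := by
    have h : F.card = Nat.card L := (Nat.card_eq_card_finite_toFinset _).symm
    rw [h, Module.natCard_eq_pow_finrank (K := ZMod 2), Nat.card_zmod]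
    exact Nat.pow_le_pow_right two_pos hL
  obtain ⟨E, hE₀, hE, hreg⟩ := exists_regular_kernel F (by simp [F]) (2 ^ D) E₀
  obtain ⟨P, s, hP, hs⟩ := exists_projection E
  have hfix : ∀ x, (∀ l ∈ E, l x = 0) → P x = x := fun x hx => by
    conv_rhs => rw [hs x, sum_eq_zero fun l _ => by rw [hx l.1 l.2, zero_smul], add_zero]
  refine ⟨E, P, s, hE₀, hE.trans (by gcongr), hP, hs, ?_⟩
  rintro E' hE' _ ⟨b, hb, rfl⟩ hvan
  have h := hreg E' hE' b (by simpa [F] using hb) fun x y hx hy => by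
    have h := hvan x y (fun l hl => hx l (mem_union_right _ hl))
      fun l hl => hy l (mem_union_right _ hl)
    rwa [precompBilinear_apply, hfix x fun l hl => hx l (mem_union_left _ hl),
      hfix y fun l hl => hy l (mem_union_left _ hl)] at h
  ext x y
  exact h _ _ (hP x) (hP y)

lemma LinearMap.flip_mem_span_range_sum_flip {ι : Type*}
    (B : ι → (V →ₗ[ZMod 2] V →ₗ[ZMod 2] ZMod 2)) {b : V →ₗ[ZMod 2] V →ₗ[ZMod 2] ZMod 2}
    (hb : b ∈ Submodule.span (ZMod 2) (Set.range (Sum.elim B fun t => (B t).flip))) :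
    b.flip ∈ Submodule.span (ZMod 2) (Set.range (Sum.elim B fun t => (B t).flip)) := by
  induction hb using Submodule.span_induction with
  | mem b hb =>
    obtain ⟨t | t, rfl⟩ := hb
    · exact Submodule.subset_span ⟨Sum.inr t, rfl⟩
    · exact Submodule.subset_span ⟨Sum.inl t, rfl⟩
  | zero => exact zero_mem _
  | add b b' _ _ h h' => exact add_mem h h'
  | smul r b _ h => exact Submodule.smul_mem _ r h

/-- A form symmetric in its first three variables and alternating in the first two, which is
invariant under exchanging the last two variables up to small partition rank, is close to a
symmetric form. -/
theorem IsMultilinear.exists_symmetricForm [Finite V] {α : (Fin 4 → V) → ZMod 2}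
    (hα : IsMultilinear 4 α) (hsymm : SymmetricInFirst 4 3 α)
    (halt : ∀ u x y : V, α ![u, u, x, y] = 0) {m : ℕ}
    (hm : PrankDecompOn 4 univ m (α + permForm 4 (Equiv.swap 2 3) α)) :
    ∃ α' : (Fin 4 → V) → ZMod 2, IsMultilinear 4 α' ∧ SymmetricForm 4 α' ∧
      prank 4 (α + α') ≤
        4 * (m + (2 ^ (12 * m) - 1) * 2 ^ (12 * m)) + 3 * (12 * m * (12 * m)) := by
  classical
  obtain ⟨I, β, γ, -, hI₁, hI₂, hβ, hγ, hφ⟩ := hm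
  choose l p q hlpq using fun k => exists_bilinear_factors (hI₁ k) (hI₂ k) (hβ k) (hγ k)
  let B : Fin m × Fin 3 × Bool → (V →ₗ[ZMod 2] V →ₗ[ZMod 2] ZMod 2) :=
    fun t => if t.2.2 then p t.1 t.2.1 else q t.1 t.2.1
  let L := Submodule.span (ZMod 2) (Set.range (Sum.elim B fun t => (B t).flip))
  have hL : Module.finrank (ZMod 2) L ≤ 12 * m := by
    refine (finrank_range_le_card _).trans_eq ?_
    simp only [Fintype.card_sum, Fintype.card_prod, Fintype.card_fin, Fintype.card_bool]
    ring
  have hpL : ∀ k i, p k i ∈ L := fun k i => Submodule.subset_span ⟨Sum.inl (k, i, true), rfl⟩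
  have hqL : ∀ k i, q k i ∈ L := fun k i => Submodule.subset_span ⟨Sum.inl (k, i, false), rfl⟩
  obtain ⟨E, P, s, hE₀, hE, hP, hs, hreg⟩ := exists_regular_projection L hL (univ.image l)
  have hlP : ∀ k x, l k (P x) = 0 := fun k x =>
    hP x _ (hE₀ (mem_image_of_mem l (mem_univ k)))
  have : Finite (V →ₗ[ZMod 2] ZMod 2) := DFunLike.finite _
  have : Finite (V →ₗ[ZMod 2] V →ₗ[ZMod 2] ZMod 2) := DFunLike.finite _
  have hL' : Module.finrank (ZMod 2) (L.map (precompBilinear P)) ≤ 12 * m :=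
    (Submodule.finrank_map_le _ _).trans hL
  have h₀₁ : ∀ x y z w, α ![x, y, z, w] = α ![y, x, z, w] := fun x y z w => by
    rw [← congrFun (hsymm 0 1 (by decide) (by decide)) ![x, y, z, w]]
    exact congrArg α (funext fun t => by fin_cases t <;> rfl)
  have h₁₂ : ∀ x y z w, α ![x, y, z, w] = α ![x, z, y, w] := fun x y z w => by
    rw [← congrFun (hsymm 1 2 (by decide) (by decide)) ![x, y, z, w]]
    exact congrArg α (funext fun t => by fin_cases t <;> rfl)
  obtain ⟨ι, _, e, c, hι, hT, hf⟩ := exists_tensor_correction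
    (L := L.map (precompBilinear P))
    (by rintro _ ⟨b, hb, rfl⟩; exact ⟨b.flip, LinearMap.flip_mem_span_range_sum_flip B hb, rfl⟩)
    (fun E' hE' => hreg E' (hE'.trans (Nat.pow_le_pow_right two_pos hL')))
    (fun x y z w => α ![P x, P y, P z, P w]) (fun x y z w => h₀₁ _ _ _ _)
    (fun x y z w => h₁₂ _ _ _ _) (fun x z w => halt _ _ _)
    (fun k i => precompBilinear P (p k i)) (fun k i => precompBilinear P (q k i))
    (fun k i => Submodule.mem_map_of_mem (hpL k i)) (fun k i => Submodule.mem_map_of_mem (hqL k i))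
    (fun x y z w => by
      have h : permForm 4 (Equiv.swap 2 3) α ![P x, P y, P z, P w] = α ![P x, P y, P w, P z] :=
        congrArg α (funext fun t => by fin_cases t <;> rfl)
      rw [← h, ← Pi.add_apply α, hφ]
      refine sum_congr rfl fun k _ => (hlpq k _ fun i => ?_)
      fin_cases i <;> exact hlP k _)
  have hσ := prankDecompIndexed_tensorForm e c
  have hprank := ((hα.prankDecompIndexed_add_comp hs).add hσ).prank_le
  have hvec : ∀ x : Fin 4 → V, (fun t => P (x t)) = ![P (x 0), P (x 1), P (x 2), P (x 3)] :=
    fun x => funext fun t => by fin_cases t <;> rfl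
  refine ⟨_, (hα.comp_linear fun _ => P).add hσ.isMultilinear,
    symmetricForm_four ?_ ?_ ?_, ?_⟩
  · intro x y z w
    simp only [Pi.add_apply, hvec]
    simp only [Matrix.cons_val]
    rw [h₀₁, hT x y]
    ring
  · intro x y z w
    simp only [Pi.add_apply, hvec]
    simp only [Matrix.cons_val]
    rw [h₁₂, hT y z]
    ring
  · intro x y z w
    simp only [Pi.add_apply, hvec]
    simp only [Matrix.cons_val]
    have h := hf x y z w
    rw [← CharTwo.sub_eq_add, sub_eq_iff_eq_add] at h
    rw [← CharTwo.sub_eq_add, h]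
    ring
  · rw [← add_assoc]
    refine hprank.trans ?_
    simp only [Fintype.card_sum, Fintype.card_prod, Fintype.card_fin, Fintype.card_coe, hι]
    have hE' : E.card ≤ m + (2 ^ (12 * m) - 1) * 2 ^ (12 * m) :=
      hE.trans (Nat.add_le_add_right (card_image_le.trans_eq (by simp)) _)
    gcongr

end SymmetryExtension

lemma correction_bound (m : ℕ) :
    4 * (m + (2 ^ (12 * m) - 1) * 2 ^ (12 * m)) + 3 * (12 * m * (12 * m)) ≤ 2 ^ (27 * m) := by
  rcases m.eq_zero_or_pos with rfl | hm
  · simp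
  obtain ⟨t, ht⟩ : ∃ t, 2 ^ (12 * m) = t + 1 := Nat.exists_eq_succ_of_ne_zero (by positivity)
  have hlt : 12 * m < 2 ^ (12 * m) := Nat.lt_two_pow_self
  have h : 2 ^ (12 * m) * 2 ^ (12 * m) * 8 ≤ 2 ^ (27 * m) := by
    rw [← pow_add, show 8 = 2 ^ 3 by rfl, ← pow_add]
    exact Nat.pow_le_pow_right two_pos (by omega)
  refine le_trans ?_ h
  rw [ht] at hlt ⊢
  rw [Nat.add_sub_cancel]
  nlinarith

/-- **Theorem 6 (symmetry extension for 4-variable forms).**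
There is an absolute constant `C ≥ 1` such that: if `α : G⁴ → 𝔽₂` is multilinear,
symmetric in its first three variables, satisfies `α(u,u,x₃,x₄) = 0`, and
`prank(α + α∘(3 4)) ≤ r`, then some symmetric multilinear form `α'` satisfies
`prank(α + α') ≤ exp(exp(C·r))`. -/
theorem statement3 :
    ∃ C : ℝ, 1 ≤ C ∧
      ∀ (n : ℕ) (α : (Fin 4 → (Fin n → ZMod 2)) → ZMod 2), IsMultilinear 4 α →
        SymmetricInFirst 4 3 α →
        (∀ u x y : Fin n → ZMod 2, α ![u, u, x, y] = 0) →
        ∀ r : ℕ, prank 4 (α + permForm 4 (Equiv.swap 2 3) α) ≤ r →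
          ∃ α' : (Fin 4 → (Fin n → ZMod 2)) → ZMod 2,
            IsMultilinear 4 α' ∧ SymmetricForm 4 α' ∧
            (prank 4 (α + α') : ℝ) ≤ Real.exp (Real.exp (C * r)) := by
  refine ⟨27, by norm_num, fun n α hα hsymm halt r hr => ?_⟩
  have hφ := hα.add (hα.comp_perm (Equiv.swap 2 3))
  obtain ⟨α', h₁, h₂, h₃⟩ := hα.exists_symmetricForm hsymm halt hφ.prankDecompOn_prank
  refine ⟨α', h₁, h₂, ?_⟩
  have h : prank 4 (α + α') ≤ 2 ^ (27 * r) :=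
    (h₃.trans (correction_bound _)).trans (Nat.pow_le_pow_right two_pos (by gcongr))
  calc (prank 4 (α + α') : ℝ) ≤ 2 ^ (27 * r) := by exact_mod_cast h
  _ ≤ Real.exp 1 ^ (27 * r) := by gcongr; linarith [Real.add_one_le_exp 1]
  _ = Real.exp (27 * r) := by rw [← Real.exp_nat_mul]; push_cast; ring_nf
  _ ≤ Real.exp (Real.exp (27 * r)) := by
    gcongr; linarith [Real.add_one_le_exp (27 * r : ℝ)]
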